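/- arXiv:1305.2110 — 4 statements merged into one kernel-verified Lean document; each statement's English description precedes it below -/
import Mathlib

section
/- Let m ≥ 3, let η be the Minkowski bilinear form on ℝ^m, let W be a finite-dimensional real inner product space and A : ℝ^m →ₗ[ℝ] W a linear map; let f, e, T be the first fundamental form, energy density, and energy-momentum tensor built from η and A. If v ∈ ℝ^m satisfies η(v,v) = 1, then (m − 2)·T(v,v) ≥ T(e₀,e₀) − ∑_{i=1}^{m−1} T(eᵢ,eᵢ) (the strong energy condition (m−2)·T(v,v) ≥ tr T holds). -/
open scoped InnerProductSpace

noncomputable section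

/-- The Minkowski bilinear form of signature `(+,-,...,-)` on `ℝ^m`:
`η(u,w) = u 0 * w 0 - ∑_{i=1}^{m-1} u i * w i`. -/
def mink (m : ℕ) (u w : Fin m → ℝ) : ℝ :=
  ∑ i : Fin m, if i.val = 0 then u i * w i else -(u i * w i)

/-- The standard basis of `ℝ^m`. -/
def stdb (m : ℕ) (a : Fin m) : Fin m → ℝ := Pi.single a 1

variable {W : Type*} [NormedAddCommGroup W] [InnerProductSpace ℝ W] [FiniteDimensional ℝ W]

/-- The first fundamental form `f(u,w) = ⟪A u, A w⟫` built from the differential `A = dφ`. -/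
def firstFF {m : ℕ} (A : (Fin m → ℝ) →ₗ[ℝ] W) (u w : Fin m → ℝ) : ℝ := ⟪A u, A w⟫_ℝ

/-- The energy density `e = (1/2)·(f(e₀,e₀) - ∑_{i=1}^{m-1} f(eᵢ,eᵢ))`, the η-trace of `f`. -/
def energyDens (m : ℕ) [NeZero m] (A : (Fin m → ℝ) →ₗ[ℝ] W) : ℝ :=
  (1 / 2) * (firstFF A (stdb m 0) (stdb m 0) -
    ∑ i ∈ Finset.univ.erase (0 : Fin m), firstFF A (stdb m i) (stdb m i))

/-- The energy-momentum tensor `T(u,w) = f(u,w) - e·η(u,w)`. -/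
def emTensor (m : ℕ) [NeZero m] (A : (Fin m → ℝ) →ₗ[ℝ] W) (u w : Fin m → ℝ) : ℝ :=
  firstFF A u w - energyDens m A * mink m u w

theorem mink_stdb_zero (m : ℕ) [NeZero m] : mink m (stdb m 0) (stdb m 0) = 1 := by
  rw [mink, Finset.sum_eq_single_of_mem 0 (Finset.mem_univ _)]
  · simp [stdb]
  · intro i _ hi
    simp [stdb, hi]

theorem mink_stdb_of_ne_zero {m : ℕ} [NeZero m] {a : Fin m} (ha : a ≠ 0) :
    mink m (stdb m a) (stdb m a) = -1 := by
  rw [mink, Finset.sum_eq_single_of_mem a (Finset.mem_univ _)]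
  · have : a.val ≠ 0 := fun h => ha (Fin.ext (by simpa using h))
    simp [stdb, this]
  · intro i _ hi
    simp [stdb, hi]

/-- The `η`-trace of the energy-momentum tensor is `(2 - m) e`. -/
theorem trace_emTensor (m : ℕ) [NeZero m] (A : (Fin m → ℝ) →ₗ[ℝ] W) :
    emTensor m A (stdb m 0) (stdb m 0) -
        ∑ i ∈ Finset.univ.erase (0 : Fin m), emTensor m A (stdb m i) (stdb m i) =
      (2 - (m : ℝ)) * energyDens m A := by
  have hsum : ∑ i ∈ Finset.univ.erase (0 : Fin m), emTensor m A (stdb m i) (stdb m i) =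
      ∑ i ∈ Finset.univ.erase (0 : Fin m), firstFF A (stdb m i) (stdb m i) +
        ((m : ℝ) - 1) * energyDens m A := by
    have hterm : ∀ i ∈ Finset.univ.erase (0 : Fin m), emTensor m A (stdb m i) (stdb m i) =
        firstFF A (stdb m i) (stdb m i) + energyDens m A := fun i hi => by
      rw [emTensor, mink_stdb_of_ne_zero (Finset.ne_of_mem_erase hi)]
      ring
    rw [Finset.sum_congr rfl hterm, Finset.sum_add_distrib, Finset.sum_const,
      Finset.card_erase_of_mem (Finset.mem_univ _), Finset.card_univ, Fintype.card_fin,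
      nsmul_eq_mul, Nat.cast_pred (NeZero.pos m)]
  have he : 2 * energyDens m A = firstFF A (stdb m 0) (stdb m 0) -
      ∑ i ∈ Finset.univ.erase (0 : Fin m), firstFF A (stdb m i) (stdb m i) := by
    rw [energyDens]
    ring
  rw [hsum, emTensor, mink_stdb_zero]
  linear_combination -he

/-- the strong energy condition `(m-2)·T(v,v) ≥ tr T`. -/
theorem stmt4 (m : ℕ) [NeZero m] (hm : 3 ≤ m)
    (A : (Fin m → ℝ) →ₗ[ℝ] W) (v : Fin m → ℝ) (hv : mink m v v = 1) :
    ((m : ℝ) - 2) * emTensor m A v v ≥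
      emTensor m A (stdb m 0) (stdb m 0) -
        ∑ i ∈ Finset.univ.erase (0 : Fin m), emTensor m A (stdb m i) (stdb m i) := by
  have hm' : (0 : ℝ) ≤ (m : ℝ) - 2 := by
    have : (3 : ℝ) ≤ m := by exact_mod_cast hm
    linarith
  have hf : 0 ≤ firstFF A v v := real_inner_self_nonneg
  rw [trace_emTensor, emTensor, hv]
  nlinarith [mul_nonneg hm' hf]
end
end

section
/- Let m ≥ 3, let η be the Minkowski bilinear form on ℝ^m, let W be a finite-dimensional real inner product space and A : ℝ^m →ₗ[ℝ] W a linear map; let f, e, T be the first fundamental form, energy density, and energy-momentum tensor built from η and A. Let l, n ∈ ℝ^m satisfy η(l,l) = 0, η(n,n) = 0, η(l,n) = 1, and define the momentum one-form I by I(u) := T(u,l) with η-norm squared |I|² := T(e₀,l)² − ∑_{i=1}^{m−1} T(eᵢ,l)². Then 0 ≤ |I|² ≤ 2·T(l,l)·T(l,n). -/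
open scoped InnerProductSpace

noncomputable section

variable {W : Type*} [NormedAddCommGroup W] [InnerProductSpace ℝ W] [FiniteDimensional ℝ W]

lemma mink_eq_sub_sum {m : ℕ} [NeZero m] (u w : Fin m → ℝ) :
    mink m u w = u 0 * w 0 - ∑ i ∈ Finset.univ.erase (0 : Fin m), u i * w i := by
  have h : ∑ i ∈ Finset.univ.erase (0 : Fin m),
      (if i.val = 0 then u i * w i else -(u i * w i)) =
      ∑ i ∈ Finset.univ.erase (0 : Fin m), -(u i * w i) :=
    Finset.sum_congr rfl fun i hi => if_neg fun h =>
      Finset.ne_of_mem_erase hi (Fin.ext (by simpa using h))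
  rw [mink, ← Finset.add_sum_erase Finset.univ _ (Finset.mem_univ (0 : Fin m)), h,
    Finset.sum_neg_distrib, if_pos (by simp), sub_eq_add_neg]

lemma mink_add_left {m : ℕ} (u v w : Fin m → ℝ) :
    mink m (u + v) w = mink m u w + mink m v w := by
  simp only [mink, ← Finset.sum_add_distrib]
  refine Finset.sum_congr rfl fun i _ => ?_
  split_ifs <;> simp only [Pi.add_apply] <;> ring

lemma mink_smul_left {m : ℕ} (c : ℝ) (u w : Fin m → ℝ) :
    mink m (c • u) w = c * mink m u w := by
  simp only [mink, Finset.mul_sum]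
  refine Finset.sum_congr rfl fun i _ => ?_
  split_ifs <;> simp only [Pi.smul_apply, smul_eq_mul] <;> ring

lemma mink_stdb_left {m : ℕ} (i : Fin m) (w : Fin m → ℝ) :
    mink m (stdb m i) w = if i.val = 0 then w i else -w i := by
  unfold mink stdb
  rw [Finset.sum_eq_single i (fun j _ hj => by simp [Pi.single_eq_of_ne hj]) (by simp)]
  simp

/-- The momentum one-form `T(·,l)` as a linear functional. -/
def momentum {m : ℕ} [NeZero m] (A : (Fin m → ℝ) →ₗ[ℝ] W) (l : Fin m → ℝ) :
    (Fin m → ℝ) →ₗ[ℝ] ℝ where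
  toFun u := emTensor m A u l
  map_add' u v := by
    simp only [emTensor, firstFF, map_add, inner_add_left, mink_add_left]; ring
  map_smul' c u := by
    simp only [emTensor, firstFF, map_smul, inner_smul_left, mink_smul_left, RingHom.id_apply,
      smul_eq_mul, conj_trivial]
    ring

/-- A vector orthogonal to both null vectors `l` and `n`, obtained from `stdb m i`. The vectors
with `i ≠ 0` form a tight frame for the screen space `{l, n}^⊥`, see
`sum_firstFF_screenVec`. -/
def screenVec {m : ℕ} [NeZero m] (l n : Fin m → ℝ) (i : Fin m) : Fin m → ℝ :=
  stdb m i + ((l 0)⁻¹ * l i) • stdb m 0 + (n i - (l 0)⁻¹ * n 0 * l i) • l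

lemma time_ne_zero_of_null {m : ℕ} [NeZero m] {l n : Fin m → ℝ}
    (hll : mink m l l = 0) (hln : mink m l n = 1) : l 0 ≠ 0 := by
  intro h0
  rw [mink_eq_sub_sum, h0, zero_mul, zero_sub, neg_eq_zero,
    Finset.sum_eq_zero_iff_of_nonneg fun i _ => mul_self_nonneg _] at hll
  rw [mink_eq_sub_sum, h0, zero_mul, Finset.sum_eq_zero fun i hi => by
    rw [mul_self_eq_zero.mp (hll i hi), zero_mul]] at hln
  norm_num at hln

lemma mink_screenVec_left {m : ℕ} [NeZero m] {l : Fin m → ℝ} (n : Fin m → ℝ)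
    (hll : mink m l l = 0) (h0 : l 0 ≠ 0) {i : Fin m} (hi : i ≠ 0) :
    mink m (screenVec l n i) l = 0 := by
  have hi' : i.val ≠ 0 := fun h => hi (Fin.ext (by simpa using h))
  simp only [screenVec, mink_add_left, mink_smul_left, mink_stdb_left, hll, if_neg hi']
  simp only [Fin.coe_ofNat_eq_mod, Nat.zero_mod, if_true]
  field_simp
  ring

lemma sum_smul_map_stdb {m : ℕ} [NeZero m] {V : Type*} [NormedAddCommGroup V]
    [InnerProductSpace ℝ V]
    (A : (Fin m → ℝ) →ₗ[ℝ] V) (u : Fin m → ℝ) :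
    ∑ i ∈ Finset.univ.erase (0 : Fin m), u i • A (stdb m i) = A u - u 0 • A (stdb m 0) := by
  have h : A u = ∑ i, u i • A (stdb m i) := by
    conv_lhs => rw [pi_eq_sum_univ' u]
    simp [stdb, Pi.single, map_sum]
  rw [h, ← Finset.add_sum_erase _ _ (Finset.mem_univ (0 : Fin m)), add_sub_cancel_left]

lemma sum_mul_inner_map_stdb {m : ℕ} [NeZero m] {V : Type*} [NormedAddCommGroup V]
    [InnerProductSpace ℝ V]
    (A : (Fin m → ℝ) →ₗ[ℝ] V) (u : Fin m → ℝ)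
    (p : V) :
    ∑ i ∈ Finset.univ.erase (0 : Fin m), u i * ⟪A (stdb m i), p⟫_ℝ =
      ⟪A u, p⟫_ℝ - u 0 * ⟪A (stdb m 0), p⟫_ℝ := by
  rw [← real_inner_smul_left, ← inner_sub_left, ← sum_smul_map_stdb, sum_inner]
  simp only [real_inner_smul_left]

/-- The trace of the first fundamental form over the screen space of two null vectors. -/
lemma sum_firstFF_screenVec {m : ℕ} [NeZero m] {V : Type*} [NormedAddCommGroup V]
    [InnerProductSpace ℝ V] (A : (Fin m → ℝ) →ₗ[ℝ] V) {l n : Fin m → ℝ}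
    (hll : mink m l l = 0) (hnn : mink m n n = 0) (hln : mink m l n = 1) :
    ∑ i ∈ Finset.univ.erase (0 : Fin m), firstFF A (screenVec l n i) (screenVec l n i) =
      2 * firstFF A l n - 2 * energyDens m A := by
  have h0 := time_ne_zero_of_null hll hln
  rw [mink_eq_sub_sum] at hll hnn hln
  have hla := sum_mul_inner_map_stdb A l (A (stdb m 0))
  have hlp := sum_mul_inner_map_stdb A l (A l)
  have hnp := sum_mul_inner_map_stdb A n (A l)
  rw [real_inner_comm (A l) (A n)] at hnp
  rw [real_inner_comm (A (stdb m 0)) (A l)] at hla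
  simp only [energyDens, firstFF] at *
  set k := (l 0)⁻¹
  set S := Finset.univ.erase (0 : Fin m)
  set a := A (stdb m 0)
  set p := A l
  have expand : ∀ i, ⟪A (screenVec l n i), A (screenVec l n i)⟫_ℝ =
      ⟪A (stdb m i), A (stdb m i)⟫_ℝ + 2 * k * (l i * ⟪A (stdb m i), a⟫_ℝ)
      + 2 * (n i * ⟪A (stdb m i), p⟫_ℝ) - 2 * k * n 0 * (l i * ⟪A (stdb m i), p⟫_ℝ)
      + (k ^ 2 * ⟪a, a⟫_ℝ - 2 * k ^ 2 * n 0 * ⟪a, p⟫_ℝ + k ^ 2 * n 0 ^ 2 * ⟪p, p⟫_ℝ) * (l i * l i)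
      + (2 * k * ⟪a, p⟫_ℝ - 2 * k * n 0 * ⟪p, p⟫_ℝ) * (l i * n i)
      + ⟪p, p⟫_ℝ * (n i * n i) := by
    intro i
    simp only [screenVec, map_add, map_smul, inner_add_left, inner_add_right,
      real_inner_smul_left, real_inner_smul_right]
    rw [real_inner_comm (A (stdb m i)) (A (stdb m 0)), real_inner_comm (A (stdb m i)) (A l),
      real_inner_comm (A (stdb m 0)) (A l)]
    ring
  simp only [expand, Finset.sum_add_distrib, Finset.sum_sub_distrib, ← Finset.mul_sum]
  rw [hla, hlp, hnp, ← sub_eq_zero.mp hll, ← sub_eq_zero.mp hnn,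
    show ∑ i ∈ S, l i * n i = l 0 * n 0 - 1 by linarith]
  simp only [k]
  field_simp
  ring

/-- for lightlike `l`, `n` with `η(l,n) = 1`, the momentum one-form
`I = T(·,l)` satisfies `0 ≤ |I|² ≤ 2·T(l,l)·T(l,n)`. -/
theorem stmt8 (m : ℕ) [NeZero m] (hm : 3 ≤ m)
    (A : (Fin m → ℝ) →ₗ[ℝ] W) (l n : Fin m → ℝ)
    (hll : mink m l l = 0) (hnn : mink m n n = 0) (hln : mink m l n = 1) :
    0 ≤ emTensor m A (stdb m 0) l ^ 2 -
        ∑ i ∈ Finset.univ.erase (0 : Fin m), emTensor m A (stdb m i) l ^ 2 ∧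
      emTensor m A (stdb m 0) l ^ 2 -
          ∑ i ∈ Finset.univ.erase (0 : Fin m), emTensor m A (stdb m i) l ^ 2 ≤
        2 * emTensor m A l l * emTensor m A l n := by
  have h0 := time_ne_zero_of_null hll hln
  have hA := sum_firstFF_screenVec A hll hnn hln
  have hI := sum_firstFF_screenVec (momentum A l) hll hnn hln
  have hT : emTensor m A l l = firstFF A l l := by rw [emTensor, hll, mul_zero, sub_zero]
  have hTn : 2 * emTensor m A l n =
      ∑ i ∈ Finset.univ.erase (0 : Fin m), firstFF A (screenVec l n i) (screenVec l n i) := by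
    rw [hA, emTensor, hln]; ring
  have hnl : emTensor m A n l = emTensor m A l n := by
    simp only [emTensor, firstFF, mink, mul_comm (n _), real_inner_comm]
  have hI' : ∑ i ∈ Finset.univ.erase (0 : Fin m), emTensor m A (screenVec l n i) l ^ 2 =
      2 * emTensor m A l l * emTensor m A l n - (emTensor m A (stdb m 0) l ^ 2 -
        ∑ i ∈ Finset.univ.erase (0 : Fin m), emTensor m A (stdb m i) l ^ 2) := by
    have hmom (u w : Fin m → ℝ) :
        firstFF (momentum A l) u w = emTensor m A w l * emTensor m A u l := rfl
    simp only [energyDens, hmom, hnl, ← sq] at hI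
    linarith
  have hCS : ∑ i ∈ Finset.univ.erase (0 : Fin m), emTensor m A (screenVec l n i) l ^ 2 ≤
      2 * emTensor m A l l * emTensor m A l n := by
    rw [mul_right_comm, hTn, hT, Finset.sum_mul]
    refine Finset.sum_le_sum fun i hi => ?_
    rw [emTensor, mink_screenVec_left n hll h0 (Finset.ne_of_mem_erase hi), mul_zero, sub_zero, sq]
    exact real_inner_mul_inner_self_le _ _
  have hpos : 0 ≤ ∑ i ∈ Finset.univ.erase (0 : Fin m), emTensor m A (screenVec l n i) l ^ 2 :=
    Finset.sum_nonneg fun i _ => sq_nonneg _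
  constructor <;> linarith
end
end

section
/- Let m ≥ 3, let η be the Minkowski bilinear form on ℝ^m, let W be a finite-dimensional real inner product space and A : ℝ^m →ₗ[ℝ] W a linear map; let f, e, T be the first fundamental form, energy density, and energy-momentum tensor built from η and A. If v ∈ ℝ^m is a nonzero causal vector, i.e. η(v,v) ≥ 0, then T(v,v) ≥ 0 and T(e₀,v)² − ∑_{i=1}^{m−1} T(eᵢ,v)² ≥ 0 (the momentum one-form T(·,v) is again causal). -/
open scoped InnerProductSpace

noncomputable section

variable {W : Type*} [NormedAddCommGroup W] [InnerProductSpace ℝ W] [FiniteDimensional ℝ W]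

theorem sum_sq_sum_le_sq_sum {ι κ : Type*} [Fintype ι] [Fintype κ] (x : κ → ℝ) (z : κ → ι → ℝ)
    (hx : ∀ k, 0 ≤ x k) (hz : ∀ k, ∑ i, z k i ^ 2 ≤ x k ^ 2) :
    ∑ i, (∑ k, z k i) ^ 2 ≤ (∑ k, x k) ^ 2 := by
  have hnorm (k : κ) : ‖WithLp.toLp 2 (z k)‖ ≤ x k := by
    rw [EuclideanSpace.norm_eq]
    refine Real.sqrt_le_iff.2 ⟨hx k, ?_⟩
    simpa using hz k
  have hsum : ‖∑ k, WithLp.toLp 2 (z k)‖ ≤ ∑ k, x k := norm_sum_le_of_le _ fun k _ => hnorm k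
  have hsq := pow_le_pow_left₀ (norm_nonneg _) hsum 2
  rw [EuclideanSpace.norm_sq_eq] at hsq
  simpa using hsq

/-- The momentum of a single scalar component with differential `(a, b)`, contracted with a
future-directed causal vector `(t, y)`, lies in the future cone. -/
theorem scalar_momentum_mem_cone {ι : Type*} [Fintype ι] (t a : ℝ) (y b : ι → ℝ) (ht : 0 ≤ t)
    (hy : ∑ i, y i ^ 2 ≤ t ^ 2) :
    0 ≤ a * (a * t + ∑ i, y i * b i) - 1 / 2 * (a ^ 2 - ∑ i, b i ^ 2) * t ∧
    ∑ i, (b i * (a * t + ∑ j, y j * b j) + 1 / 2 * (a ^ 2 - ∑ j, b j ^ 2) * y i) ^ 2 ≤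
      (a * (a * t + ∑ i, y i * b i) - 1 / 2 * (a ^ 2 - ∑ i, b i ^ 2) * t) ^ 2 := by
  have hcs := Finset.sum_mul_sq_le_sq_mul_sq Finset.univ y b
  have hexp (c e : ℝ) : ∑ i, (b i * c + e * y i) ^ 2 =
      c ^ 2 * ∑ i, b i ^ 2 + 2 * c * e * ∑ i, y i * b i + e ^ 2 * ∑ i, y i ^ 2 := by
    simp only [Finset.mul_sum, ← Finset.sum_add_distrib]
    exact Finset.sum_congr rfl fun i _ => by ring
  have hq : 0 ≤ ∑ i, b i ^ 2 := Finset.sum_nonneg fun i _ => sq_nonneg _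
  rw [hexp]
  generalize ∑ i, y i * b i = p at *
  generalize ∑ i, b i ^ 2 = q at *
  generalize ∑ i, y i ^ 2 = r at *
  constructor
  · have hp : (a * p) ^ 2 ≤ (1 / 2 * (a ^ 2 + q) * t) ^ 2 := by
      have h1 : p ^ 2 ≤ t ^ 2 * q := hcs.trans (mul_le_mul_of_nonneg_right hy hq)
      have h2 := mul_le_mul_of_nonneg_left h1 (sq_nonneg a)
      nlinarith [mul_nonneg (sq_nonneg t) (sq_nonneg (a ^ 2 - q))]
    have := (abs_le_of_sq_le_sq' hp (by positivity)).1
    linarith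
  · have := mul_nonneg (sq_nonneg (1 / 2 * (a ^ 2 - q))) (sub_nonneg.2 hy)
    linarith

theorem add_sum_mul_nonneg_of_mem_cone {ι : Type*} [Fintype ι] (t x : ℝ) (y z : ι → ℝ)
    (ht : 0 ≤ t) (hx : 0 ≤ x) (hy : ∑ i, y i ^ 2 ≤ t ^ 2) (hz : ∑ i, z i ^ 2 ≤ x ^ 2) :
    0 ≤ t * x + ∑ i, y i * z i := by
  have hcs := Finset.sum_mul_sq_le_sq_mul_sq Finset.univ y z
  have h : (∑ i, y i * z i) ^ 2 ≤ (t * x) ^ 2 := by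
    rw [mul_pow]
    exact hcs.trans (mul_le_mul hy hz (Finset.sum_nonneg fun i _ => sq_nonneg _) (sq_nonneg t))
  linarith [(abs_le_of_sq_le_sq' h (mul_nonneg ht hx)).1]

theorem sum_erase_zero_fin {n : ℕ} (g : Fin (n + 1) → ℝ) :
    ∑ i ∈ Finset.univ.erase (0 : Fin (n + 1)), g i = ∑ i : Fin n, g i.succ := by
  have h := Finset.add_sum_erase Finset.univ g (Finset.mem_univ 0)
  rw [Fin.sum_univ_succ] at h
  linarith

theorem mink_succ {n : ℕ} (u w : Fin (n + 1) → ℝ) :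
    mink (n + 1) u w = u 0 * w 0 - ∑ i : Fin n, u i.succ * w i.succ := by
  simp [mink, Fin.sum_univ_succ, sub_eq_add_neg]

theorem mink_stdb_zero_s10 {n : ℕ} (w : Fin (n + 1) → ℝ) : mink (n + 1) (stdb (n + 1) 0) w = w 0 := by
  simp [mink_succ, stdb]

theorem mink_stdb_succ {n : ℕ} (i : Fin n) (w : Fin (n + 1) → ℝ) :
    mink (n + 1) (stdb (n + 1) i.succ) w = -w i.succ := by
  simp [mink_succ, stdb, Pi.single_apply]

section

variable {W : Type*} [NormedAddCommGroup W] [InnerProductSpace ℝ W]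

theorem map_eq_add_sum_stdb {n : ℕ} (A : (Fin (n + 1) → ℝ) →ₗ[ℝ] W) (v : Fin (n + 1) → ℝ) :
    A v = v 0 • A (stdb (n + 1) 0) + ∑ i : Fin n, v i.succ • A (stdb (n + 1) i.succ) := by
  conv_lhs => rw [pi_eq_sum_univ' v]
  simp only [Fin.sum_univ_succ, map_add, map_sum, map_smul, stdb]

theorem emTensor_self_eq {n : ℕ} (A : (Fin (n + 1) → ℝ) →ₗ[ℝ] W) (v : Fin (n + 1) → ℝ) :
    emTensor (n + 1) A v v = v 0 * emTensor (n + 1) A (stdb (n + 1) 0) v +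
      ∑ i : Fin n, v i.succ * emTensor (n + 1) A (stdb (n + 1) i.succ) v := by
  have hf : firstFF A v v = v 0 * firstFF A (stdb (n + 1) 0) v +
      ∑ i : Fin n, v i.succ * firstFF A (stdb (n + 1) i.succ) v := by
    unfold firstFF
    conv_lhs => enter [2]; rw [map_eq_add_sum_stdb A v]
    simp [inner_add_left, sum_inner, real_inner_smul_left]
  simp only [emTensor, hf, mink_stdb_zero_s10, mink_stdb_succ, mink_succ v v, mul_sub,
    Finset.sum_sub_distrib, Finset.mul_sum]
  have h : ∑ i : Fin n, v i.succ * (energyDens (n + 1) A * -v i.succ) =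
      -∑ i : Fin n, energyDens (n + 1) A * (v i.succ * v i.succ) := by
    rw [← Finset.sum_neg_distrib]
    exact Finset.sum_congr rfl fun i _ => by ring
  rw [h]
  ring

theorem emTensor_neg_right {m : ℕ} [NeZero m] (A : (Fin m → ℝ) →ₗ[ℝ] W) (u w : Fin m → ℝ) :
    emTensor m A u (-w) = -emTensor m A u w := by
  have hm : mink m u (-w) = -mink m u w := by
    simp only [mink, ← Finset.sum_neg_distrib]
    exact Finset.sum_congr rfl fun i _ => by split_ifs <;> simp
  simp only [emTensor, firstFF, hm, map_neg, inner_neg_right]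
  ring

theorem emTensor_neg_left {m : ℕ} [NeZero m] (A : (Fin m → ℝ) →ₗ[ℝ] W) (u w : Fin m → ℝ) :
    emTensor m A (-u) w = -emTensor m A u w := by
  have hm : mink m (-u) w = -mink m u w := by
    simp only [mink, ← Finset.sum_neg_distrib]
    exact Finset.sum_congr rfl fun i _ => by split_ifs <;> simp
  simp only [emTensor, firstFF, hm, map_neg, inner_neg_left]
  ring

theorem momentum_mem_cone [FiniteDimensional ℝ W] {n : ℕ} (A : (Fin (n + 1) → ℝ) →ₗ[ℝ] W)
    (v : Fin (n + 1) → ℝ) (ht : 0 ≤ v 0) (hy : ∑ i : Fin n, v i.succ ^ 2 ≤ v 0 ^ 2) :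
    0 ≤ emTensor (n + 1) A (stdb (n + 1) 0) v ∧
      ∑ i : Fin n, emTensor (n + 1) A (stdb (n + 1) i.succ) v ^ 2 ≤
        emTensor (n + 1) A (stdb (n + 1) 0) v ^ 2 := by
  let B := stdOrthonormalBasis ℝ W
  let a k := ⟪B k, A (stdb (n + 1) 0)⟫_ℝ
  let b k (i : Fin n) := ⟪B k, A (stdb (n + 1) i.succ)⟫_ℝ
  have hf (u w : Fin (n + 1) → ℝ) :
      firstFF A u w = ∑ k, ⟪B k, A u⟫_ℝ * ⟪B k, A w⟫_ℝ := by
    rw [firstFF, ← B.sum_inner_mul_inner]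
    exact Finset.sum_congr rfl fun k _ => by rw [real_inner_comm]
  have hAv k : ⟪B k, A v⟫_ℝ = a k * v 0 + ∑ i : Fin n, v i.succ * b k i := by
    rw [map_eq_add_sum_stdb A v]
    simp only [inner_add_right, inner_sum, real_inner_smul_right, a, b, mul_comm (v 0)]
  have he : energyDens (n + 1) A = ∑ k, 1 / 2 * (a k ^ 2 - ∑ i, b k i ^ 2) := by
    rw [energyDens, sum_erase_zero_fin, ← Finset.mul_sum, Finset.sum_sub_distrib,
      Finset.sum_comm]
    simp only [hf, a, b, sq]
  have h0 : emTensor (n + 1) A (stdb (n + 1) 0) v = ∑ k, (a k * (a k * v 0 +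
      ∑ i : Fin n, v i.succ * b k i) - 1 / 2 * (a k ^ 2 - ∑ i, b k i ^ 2) * v 0) := by
    rw [emTensor, mink_stdb_zero_s10, he, hf, Finset.sum_mul, ← Finset.sum_sub_distrib]
    simp only [hAv, a]
  have hs (i : Fin n) : emTensor (n + 1) A (stdb (n + 1) i.succ) v = ∑ k, (b k i * (a k * v 0 +
      ∑ j : Fin n, v j.succ * b k j) + 1 / 2 * (a k ^ 2 - ∑ j, b k j ^ 2) * v i.succ) := by
    rw [emTensor, mink_stdb_succ, he, hf, mul_neg, sub_neg_eq_add, Finset.sum_mul,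
      ← Finset.sum_add_distrib]
    simp only [hAv, b]
  have hk k := scalar_momentum_mem_cone (v 0) (a k) (fun i : Fin n => v i.succ) (b k) ht hy
  simp only [h0, hs]
  exact ⟨Finset.sum_nonneg fun k _ => (hk k).1,
    sum_sq_sum_le_sq_sum _ _ (fun k => (hk k).1) fun k => (hk k).2⟩

end

/-- dominant energy condition — for a nonzero causal vector `v`,
the energy density `T(v,v)` is nonnegative and the momentum one-form `T(·,v)` is causal. -/
theorem stmt10 (m : ℕ) [NeZero m] (hm : 3 ≤ m)
    (A : (Fin m → ℝ) →ₗ[ℝ] W) (v : Fin m → ℝ) (hv0 : v ≠ 0) (hv : 0 ≤ mink m v v) :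
    0 ≤ emTensor m A v v ∧
      0 ≤ emTensor m A (stdb m 0) v ^ 2 -
        ∑ i ∈ Finset.univ.erase (0 : Fin m), emTensor m A (stdb m i) v ^ 2 := by
  obtain ⟨n, rfl⟩ : ∃ n, m = n + 1 := ⟨m - 1, by omega⟩
  wlog ht : 0 ≤ v 0 generalizing v
  · have h := this (-v) (neg_ne_zero.2 hv0) (by simpa [mink] using hv)
      (by simpa using (not_le.1 ht).le)
    simpa only [emTensor_neg_right, emTensor_neg_left, neg_neg, neg_sq] using h
  have hy : ∑ i : Fin n, v i.succ ^ 2 ≤ v 0 ^ 2 := by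
    rw [mink_succ] at hv
    simpa only [sq, sub_nonneg] using hv
  obtain ⟨h0, hs⟩ := momentum_mem_cone A v ht hy
  refine ⟨?_, ?_⟩
  · rw [emTensor_self_eq]
    exact add_sum_mul_nonneg_of_mem_cone _ _ _ _ ht h0 hy hs
  · rw [sum_erase_zero_fin]
    exact sub_nonneg.2 hs
end
end

section
/- Let m ≥ 3, let η be the Minkowski bilinear form on ℝ^m, let W be a finite-dimensional real inner product space, A : ℝ^m →ₗ[ℝ] W a linear map, κ ∈ ℝ with κ ≠ 0, and let R be a symmetric bilinear form on ℝ^m satisfying κ·R(u,w) = ⟪A u, A w⟫ for all u, w. Define G(u,w) := R(u,w) − (1/2)·(R(e₀,e₀) − ∑_{i=1}^{m−1} R(eᵢ,eᵢ))·η(u,w). Let l ∈ ℝ^m with l ≠ 0 and η(l,l) = 0, and assume G(u,l) = 0 for all u. Then there exists w₀ ∈ W such that A u = η(l,u) • w₀ for all u ∈ ℝ^m, and consequently κ·R(u,z) = ⟪w₀,w₀⟫·η(l,u)·η(l,z) for all u, z, and the η-trace of R vanishes: R(e₀,e₀) − ∑_{i=1}^{m−1} R(eᵢ,eᵢ) =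 0. -/
open scoped InnerProductSpace

noncomputable section

variable {W : Type*} [NormedAddCommGroup W] [InnerProductSpace ℝ W] [FiniteDimensional ℝ W]

theorem mink_eq_sub_sum_erase (m : ℕ) [NeZero m] (u w : Fin m → ℝ) :
    mink m u w = u 0 * w 0 - ∑ i ∈ Finset.univ.erase (0 : Fin m), u i * w i := by
  rw [mink, ← Finset.add_sum_erase _ _ (Finset.mem_univ (0 : Fin m)), sub_eq_add_neg,
    ← Finset.sum_neg_distrib]
  congr 1
  exact Finset.sum_congr rfl fun i hi => if_neg fun h =>
    Finset.ne_of_mem_erase hi (Fin.ext (by simpa using h))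

theorem mink_stdb_zero_left (m : ℕ) [NeZero m] (l : Fin m → ℝ) :
    mink m (stdb m 0) l = l 0 := by
  rw [mink_eq_sub_sum_erase, Finset.sum_eq_zero]
  · simp [stdb]
  · intro i hi
    simp [stdb, Pi.single_eq_of_ne (Finset.ne_of_mem_erase hi)]

/-- A nonzero null vector has nonvanishing time component. -/
theorem ne_zero_of_mink_self_eq_zero {m : ℕ} [NeZero m] {l : Fin m → ℝ} (hl0 : l ≠ 0)
    (hll : mink m l l = 0) : l 0 ≠ 0 := by
  intro h
  rw [mink_eq_sub_sum_erase, h, mul_zero, zero_sub, neg_eq_zero,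
    Finset.sum_eq_zero_iff_of_nonneg fun i _ => mul_self_nonneg (l i)] at hll
  refine hl0 (funext fun i => ?_)
  by_cases hi : i = 0
  · rw [hi, h, Pi.zero_apply]
  · simpa using hll i (by simp [hi])

theorem map_eq_add_sum_erase {m : ℕ} [NeZero m] {V : Type*} [AddCommGroup V] [Module ℝ V]
    (A : (Fin m → ℝ) →ₗ[ℝ] V) (u : Fin m → ℝ) :
    A u = u 0 • A (stdb m 0) + ∑ i ∈ Finset.univ.erase (0 : Fin m), u i • A (stdb m i) := by
  rw [Finset.add_sum_erase _ (fun i => u i • A (stdb m i)) (Finset.mem_univ _),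
    LinearMap.pi_apply_eq_sum_univ A u]
  refine Finset.sum_congr rfl fun i _ => ?_
  congr 2
  ext j
  simp [stdb, Pi.single_apply, eq_comm]

/-- Equality case of the Cauchy-Schwarz inequality for a weighted sum of vectors. -/
theorem eq_smul_of_sum_smul_eq {ι V : Type*} [NormedAddCommGroup V] [InnerProductSpace ℝ V]
    (s : Finset ι) (c : ι → ℝ) (a : ι → V) (v : V)
    (hsum : ∑ i ∈ s, c i • a i = (∑ i ∈ s, c i * c i) • v)
    (hnorm : ∑ i ∈ s, ⟪a i, a i⟫_ℝ = (∑ i ∈ s, c i * c i) * ⟪v, v⟫_ℝ) :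
    ∀ i ∈ s, a i = c i • v := by
  have hzero : ∑ i ∈ s, ⟪a i - c i • v, a i - c i • v⟫_ℝ = 0 := by
    have hexp : ∀ i ∈ s, ⟪a i - c i • v, a i - c i • v⟫_ℝ =
        ⟪a i, a i⟫_ℝ - 2 * ⟪c i • a i, v⟫_ℝ + c i * c i * ⟪v, v⟫_ℝ := by
      intro i _
      simp only [inner_sub_left, inner_sub_right, real_inner_smul_left, real_inner_smul_right,
        real_inner_comm (a i) v]
      ring
    rw [Finset.sum_congr rfl hexp, Finset.sum_add_distrib, Finset.sum_sub_distrib,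
      ← Finset.mul_sum, ← Finset.sum_mul, ← sum_inner, hsum, hnorm, real_inner_smul_left]
    ring
  rw [Finset.sum_eq_zero_iff_of_nonneg fun i _ => real_inner_self_nonneg] at hzero
  exact fun i hi => sub_eq_zero.1 (inner_self_eq_zero.1 (hzero i hi))

/-- the radiation condition `G(·,l) = 0` together with the Einstein equation
forces the pure-radiation form `A u = η(l,u)·w₀`, `κ·R = ⟪w₀,w₀⟫·l⊗l`, and `tr_η R = 0`. -/
theorem stmt15 (m : ℕ) [NeZero m] (hm : 3 ≤ m)
    (A : (Fin m → ℝ) →ₗ[ℝ] W) (κ : ℝ) (hκ : κ ≠ 0)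
    (R : (Fin m → ℝ) →ₗ[ℝ] (Fin m → ℝ) →ₗ[ℝ] ℝ)
    (hsym : ∀ u w : Fin m → ℝ, R u w = R w u)
    (hEin : ∀ u w : Fin m → ℝ, κ * R u w = ⟪A u, A w⟫_ℝ)
    (l : Fin m → ℝ) (hl0 : l ≠ 0) (hll : mink m l l = 0)
    (G : (Fin m → ℝ) → (Fin m → ℝ) → ℝ)
    (hG : ∀ u w : Fin m → ℝ, G u w = R u w -
      (1 / 2) * (R (stdb m 0) (stdb m 0) -
        ∑ i ∈ Finset.univ.erase (0 : Fin m), R (stdb m i) (stdb m i)) * mink m u w)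
    (hGl : ∀ u : Fin m → ℝ, G u l = 0) :
    ∃ w₀ : W, (∀ u : Fin m → ℝ, A u = mink m l u • w₀) ∧
      (∀ u z : Fin m → ℝ, κ * R u z = ⟪w₀, w₀⟫_ℝ * (mink m l u * mink m l z)) ∧
      R (stdb m 0) (stdb m 0) -
        ∑ i ∈ Finset.univ.erase (0 : Fin m), R (stdb m i) (stdb m i) = 0 := by
  have hl : l 0 ≠ 0 := ne_zero_of_mink_self_eq_zero hl0 hll
  have hR : ∀ u, R u l = (1 / 2) * (R (stdb m 0) (stdb m 0) -
      ∑ i ∈ Finset.univ.erase (0 : Fin m), R (stdb m i) (stdb m i)) * mink m u l :=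
    fun u => sub_eq_zero.1 ((hG u l).symm.trans (hGl u))
  have hAl : A l = 0 := by
    rw [← inner_self_eq_zero (𝕜 := ℝ), ← hEin, hR, hll, mul_zero, mul_zero]
  have htr : R (stdb m 0) (stdb m 0) -
      ∑ i ∈ Finset.univ.erase (0 : Fin m), R (stdb m i) (stdb m i) = 0 := by
    have h0 : R (stdb m 0) l = 0 := by
      have h := hEin (stdb m 0) l
      rw [hAl, inner_zero_right] at h
      exact (mul_eq_zero.1 h).resolve_left hκ
    rw [hR, mink_stdb_zero_left] at h0
    simpa [hl] using h0
  have htrA : ∑ i ∈ Finset.univ.erase (0 : Fin m), ⟪A (stdb m i), A (stdb m i)⟫_ℝ =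
      ⟪A (stdb m 0), A (stdb m 0)⟫_ℝ := by
    simp only [← hEin, ← Finset.mul_sum]
    rw [sub_eq_zero.1 htr]
  have hnull : ∑ i ∈ Finset.univ.erase (0 : Fin m), l i * l i = l 0 * l 0 := by
    rw [mink_eq_sub_sum_erase] at hll
    exact (sub_eq_zero.1 hll).symm
  have hspace := eq_smul_of_sum_smul_eq (Finset.univ.erase (0 : Fin m)) l
    (fun i => A (stdb m i)) (-((l 0)⁻¹ • A (stdb m 0)))
    (by
      rw [map_eq_add_sum_erase, add_comm] at hAl
      rw [eq_neg_of_add_eq_zero_left hAl, hnull, smul_neg, smul_smul]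
      field_simp)
    (by
      rw [htrA, hnull, inner_neg_neg, real_inner_smul_left, real_inner_smul_right]
      field_simp)
  have hA : ∀ u, A u = mink m l u • ((l 0)⁻¹ • A (stdb m 0)) := by
    intro u
    rw [map_eq_add_sum_erase A u, mink_eq_sub_sum_erase, sub_smul, Finset.sum_smul,
      sub_eq_add_neg, ← Finset.sum_neg_distrib]
    congr 1
    · rw [smul_smul]
      field_simp
    · refine Finset.sum_congr rfl fun i hi => ?_
      rw [hspace i hi, smul_neg, smul_neg, smul_smul (u i), mul_comm (u i)]
  refine ⟨(l 0)⁻¹ • A (stdb m 0), hA, fun u z => ?_, htr⟩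
  rw [hEin, hA u, hA z, real_inner_smul_left, real_inner_smul_right]
  ring
end
end
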